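/- arXiv:1910.10791 — 3 statements merged into one kernel-verified Lean document; each statement's English description precedes it below -/
import Mathlib

section
/- Let δ, C₁, C̄₁, C₄, C₊ > 0 and let (ω_k)_{k≥1} be a positive nonincreasing real sequence with ω_k → 0 such that ω_{k+1} − ω_k + 2δ ω_k ω_{k+1} ≥ C₊ ω_{k+1}² for all k ≥ 1, and suppose there exists an integer k₀ ≥ 1 such that inf_{k ≥ k₀} ((ω_{k+1} − ω_k)/(ω_k ω_{k+1}) + 2δ − ω_{k+1} C₁) > 0 and 1 − 2ω_{k+1}δ + ω_{k+1}² C₁ > 0 for all k ≥ k₀. Let (t_k)_{k≥1} be a nonnegative real sequence and (z_k)_{k≥1} a real sequence with |z_k| ≤ C₄ for all k, satisfying the recursion t_{k+1} ≤ (1 − 2δ ω_{k+1} + C₁ ω_{k+1}²) t_k + C̄₁ ω_{k+1}² + 2ω_{k+1}(z_k − z_{k+1}) for all k ≥ 1. Then there exists a constant λ > 0 such that t_k ≤ λ ω_k for all k ≥ 1. -/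
/-- Deterministic core of Theorem 1 (L₂ convergence rate): the perturbed
stochastic-approximation recursion `t_{k+1} ≤ (1 - 2δω_{k+1} + C₁ω_{k+1}²) t_k
+ C̄₁ ω_{k+1}² + 2ω_{k+1}(z_k - z_{k+1})` with bounded `z` satisfies
`t_k ≤ λ ω_k`. -/
theorem sgld_sa_L2_convergence_rate
    (δ C₁ Cbar₁ C₄ Cplus : ℝ)
    (hδ : 0 < δ) (hC₁ : 0 < C₁) (hCbar₁ : 0 < Cbar₁) (hC₄ : 0 < C₄)
    (hCplus : 0 < Cplus)
    (ω : ℕ → ℝ)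
    (hωpos : ∀ k, 1 ≤ k → 0 < ω k)
    (hωdec : ∀ k, 1 ≤ k → ω (k + 1) ≤ ω k)
    (hωlim : Filter.Tendsto ω Filter.atTop (nhds 0))
    (hωstep : ∀ k, 1 ≤ k →
      Cplus * (ω (k + 1)) ^ 2 ≤ ω (k + 1) - ω k + 2 * δ * ω k * ω (k + 1))
    (k₀ : ℕ) (hk₀ : 1 ≤ k₀)
    (hinf : ∃ c > (0 : ℝ), ∀ k, k₀ ≤ k →
      c ≤ (ω (k + 1) - ω k) / (ω k * ω (k + 1)) + 2 * δ - ω (k + 1) * C₁)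
    (hfacpos : ∀ k, k₀ ≤ k → 0 < 1 - 2 * ω (k + 1) * δ + (ω (k + 1)) ^ 2 * C₁)
    (t z : ℕ → ℝ)
    (ht : ∀ k, 1 ≤ k → 0 ≤ t k)
    (hz : ∀ k, 1 ≤ k → |z k| ≤ C₄)
    (hrec : ∀ k, 1 ≤ k →
      t (k + 1) ≤ (1 - 2 * δ * ω (k + 1) + C₁ * (ω (k + 1)) ^ 2) * t k
        + Cbar₁ * (ω (k + 1)) ^ 2 + 2 * ω (k + 1) * (z k - z (k + 1))) :
    ∃ lam > (0 : ℝ), ∀ k, 1 ≤ k → t k ≤ lam * ω k := by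
  obtain ⟨c, hc, hcbound⟩ := hinf
  have hgap : ∀ k, k₀ ≤ k → c * (ω k * ω (k + 1)) ≤
      ω (k + 1) - (1 - 2 * δ * ω (k + 1) + C₁ * (ω (k + 1)) ^ 2) * ω k := by
    intro k hk
    have h0 := hωpos k (hk₀.trans hk)
    have h1 := hωpos (k + 1) (by lia)
    calc c * (ω k * ω (k + 1))
        ≤ ((ω (k + 1) - ω k) / (ω k * ω (k + 1)) + 2 * δ - ω (k + 1) * C₁)
          * (ω k * ω (k + 1)) :=
        mul_le_mul_of_nonneg_right (hcbound k hk) (by positivity)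
      _ = _ := by field_simp; ring
  have hK : 0 < Cbar₁ + 4 * δ * C₄ := by positivity
  obtain ⟨M, hMK, hMstart⟩ : ∃ M, Cbar₁ + 4 * δ * C₄ ≤ M * c ∧
      t k₀ + 2 * ω k₀ * z k₀ ≤ M * ω k₀ :=
    ⟨max ((Cbar₁ + 4 * δ * C₄) / c) ((t k₀ + 2 * ω k₀ * z k₀) / ω k₀),
      (div_le_iff₀ hc).1 (le_max_left _ _),
      (div_le_iff₀ (hωpos k₀ hk₀)).1 (le_max_right _ _)⟩
  have hM : 0 < M := pos_of_mul_pos_left (hK.trans_le hMK) hc.le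
  have hshift : ∀ k, k₀ ≤ k → t k + 2 * ω k * z k ≤ M * ω k := by
    intro k hk
    induction k, hk using Nat.le_induction with
    | base => exact hMstart
    | succ k hk ih =>
      have hk1 : 1 ≤ k := hk₀.trans hk
      have h0 := hωpos k hk1
      have h1 := hωpos (k + 1) (by lia)
      have hdec := hωdec k hk1
      have hr := hrec k hk1
      have hg := hgap k hk
      have ha : 0 ≤ 1 - 2 * δ * ω (k + 1) + C₁ * (ω (k + 1)) ^ 2 := by
        linarith [hfacpos k hk]
      set a := 1 - 2 * δ * ω (k + 1) + C₁ * (ω (k + 1)) ^ 2 with ha_def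
      have hupper : ω (k + 1) - a * ω k ≤ 2 * δ * (ω k * ω (k + 1)) := by
        have : 0 ≤ C₁ * (ω (k + 1)) ^ 2 * ω k := by positivity
        rw [ha_def]
        linarith
      have hp : 0 < ω k * ω (k + 1) := mul_pos h0 h1
      have hdiff : 0 ≤ ω (k + 1) - a * ω k := (mul_pos hc hp).le.trans hg
      have hzk : z k * (ω (k + 1) - a * ω k) ≤ C₄ * (2 * δ * (ω k * ω (k + 1))) :=
        mul_le_mul ((le_abs_self _).trans (hz k hk1)) hupper hdiff hC₄.le
      have hsq : Cbar₁ * (ω (k + 1)) ^ 2 ≤ Cbar₁ * (ω k * ω (k + 1)) := by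
        rw [sq]
        gcongr
      have hih := mul_le_mul_of_nonneg_left ih ha
      have hMg := mul_le_mul_of_nonneg_left hg hM.le
      have hKp := mul_le_mul_of_nonneg_right hMK hp.le
      linarith
  have htail : ∀ k, k₀ ≤ k → t k ≤ (M + 2 * C₄) * ω k := by
    intro k hk
    have hzk := mul_le_mul_of_nonneg_right
      ((neg_le_abs _).trans (hz k (hk₀.trans hk))) (hωpos k (hk₀.trans hk)).le
    linarith [hshift k hk]
  have hS : 0 ≤ ∑ i ∈ Finset.range k₀, |t i / ω i| :=
    Finset.sum_nonneg fun _ _ => abs_nonneg _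
  refine ⟨M + 2 * C₄ + ∑ i ∈ Finset.range k₀, |t i / ω i|, by positivity, fun k hk => ?_⟩
  have h0 := hωpos k hk
  rcases le_or_gt k₀ k with h | h
  · exact (htail k h).trans (mul_le_mul_of_nonneg_right (by linarith) h0.le)
  · rw [← div_le_iff₀ h0]
    have := Finset.single_le_sum (f := fun i => |t i / ω i|)
      (fun _ _ => abs_nonneg _) (Finset.mem_range.2 h)
    linarith [le_abs_self (t k / ω k)]
end

section
/- Let α ∈ (0, 1], A > 0, B ≥ 0, and δ, C₁, C̄₁, C₄ > 0, and if α = 1 assume additionally that 2δA > 1. Define the step sizes ω_k = A(k + B)^{−α} for k ≥ 1. Let (t_k)_{k≥1} be a nonnegative real sequence and (z_k)_{k≥1} a real sequence with |z_k| ≤ C₄ for all k, satisfying the recursion t_{k+1} ≤ (1 − 2δ ω_{k+1} + C₁ ω_{k+1}²) t_k + C̄₁ ω_{k+1}² + 2ω_{k+1}(z_k − z_{k+1}) for all k ≥ 1. Then there exists a constant λ > 0 such that t_k ≤ λ k^{−α} for all k ≥ 1. -/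
open Filter Topology in
/-- A stochastic approximation recursion with a telescoping noise term `z k - z (k + 1)`
is eventually bounded by a multiple of its step size. -/
theorem eventually_le_mul_stepSize_of_recursion
    {δ C D E q : ℝ} {w t z : ℕ → ℝ} (hδ : 0 < δ) (hC : 0 < C) (hD : 0 < D)
    (hq : q < 2 * δ) (hw : ∀ k, 1 ≤ k → 0 < w k) (hw0 : Tendsto w atTop (𝓝 0))
    (hanti : ∀ k, 1 ≤ k → w (k + 1) ≤ w k)
    (hstep : ∀ᶠ k in atTop, w k - w (k + 1) ≤ q * (w k * w (k + 1)))
    (hz : ∀ k, 1 ≤ k → |z k| ≤ E)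
    (hrec : ∀ k, 1 ≤ k →
      t (k + 1) ≤ (1 - 2 * δ * w (k + 1) + C * (w (k + 1)) ^ 2) * t k
        + D * (w (k + 1)) ^ 2 + 2 * w (k + 1) * (z k - z (k + 1))) :
    ∃ lam : ℝ, ∀ᶠ k in atTop, t k ≤ lam * w k := by
  have hsmall : ∀ r > 0, ∀ᶠ k in atTop, w k < r := fun r hr => hw0.eventually_lt_const hr
  have hgap : 0 < 2 * δ - q := by linarith
  obtain ⟨N, hN⟩ := eventually_atTop.1 (hstep.and ((eventually_ge_atTop 1).and
    ((hsmall 1 one_pos).and ((hsmall (1 / (2 * δ)) (by positivity)).and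
      (hsmall ((2 * δ - q) / 2 / C) (by positivity))))))
  set M := D + 2 * E * q + 2 * E * (2 * δ + C) with hM
  set L := max (max 0 (2 * M / (2 * δ - q))) ((t N + 2 * w N * z N) / w N) with hL
  have hL0 : 0 ≤ L := (le_max_left _ _).trans (le_max_left _ _)
  have hLM : 2 * M ≤ L * (2 * δ - q) :=
    (div_le_iff₀ hgap).1 ((le_max_right _ _).trans (le_max_left _ _))
  have key : ∀ k, N ≤ k → t k + 2 * w k * z k ≤ L * w k := by
    intro k hk
    induction k, hk using Nat.le_induction with
    | base => exact (div_le_iff₀ (hw N (hN N le_rfl).2.1)).1 (le_max_right _ _)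
    | succ k hk ih =>
      obtain ⟨hd, h1, -, -, -⟩ := hN k hk
      obtain ⟨-, h1', hone, hδw, hCw⟩ := hN (k + 1) (by omega)
      have hr := hrec k h1
      have ha := hw k h1
      have hb := hw (k + 1) h1'
      have hab := hanti k h1
      have hzk := hz k h1
      rw [lt_div_iff₀ (by positivity)] at hδw hCw
      generalize w (k + 1) = b at *
      generalize w k = a at *
      generalize z k = x at *
      have hE : 0 ≤ E := (abs_nonneg x).trans hzk
      have hP : 0 < a * b := mul_pos ha hb
      have hbb : D * b ^ 2 ≤ D * (a * b) := by
        rw [sq]; gcongr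
      have hρ : 0 ≤ 1 - 2 * δ * b + C * b ^ 2 := by
        have : 0 ≤ C * b ^ 2 := by positivity
        linarith
      have hρL := mul_le_mul_of_nonneg_left ih hρ
      have hx1 : 2 * x * (b - a) ≤ 2 * E * (q * (a * b)) := by
        have h := neg_abs_le x
        calc 2 * x * (b - a) ≤ 2 * E * (a - b) := by nlinarith
          _ ≤ _ := by gcongr
      have hx2 : 2 * x * (a * b) * (2 * δ - C * b) ≤ 2 * E * (a * b) * (2 * δ + C) := by
        have hCb : C * b ≤ C := by nlinarith
        have hCb0 : 0 ≤ C * b := by positivity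
        have h : x * (2 * δ - C * b) ≤ E * (2 * δ + C) := by
          refine (le_abs_self _).trans ?_
          rw [abs_mul]
          exact mul_le_mul hzk (abs_le.2 ⟨by linarith, by linarith⟩) (abs_nonneg _) hE
        nlinarith
      have hbound : L * a * (1 - 2 * δ * b + C * b ^ 2) + M * (a * b) ≤ L * b := by
        have h1 : L * (a - b) ≤ L * (q * (a * b)) := by gcongr
        have h2 : L * (a * b) * (b * C) ≤ L * (a * b) * ((2 * δ - q) / 2) := by gcongr
        have h3 := mul_le_mul_of_nonneg_right hLM hP.le
        linarith
      rw [hM] at hbound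
      linarith
  refine ⟨L + 2 * E, eventually_atTop.2 ⟨N, fun k hk => ?_⟩⟩
  have h1 := (hN k hk).2.1
  have h2 := mul_le_mul_of_nonneg_left ((abs_le.1 (hz k h1)).1) (hw k h1).le
  linarith [key k hk]

/-- The increment of a concave power function is at most its derivative at the left endpoint. -/
theorem rpow_add_one_sub_rpow_le {α x : ℝ} (hα0 : 0 ≤ α) (hα1 : α ≤ 1) (hx : 0 < x) :
    (x + 1) ^ α - x ^ α ≤ α * x ^ (α - 1) := by
  have hx0 : 0 < 1 / x := by positivity
  have h := rpow_one_add_le_one_add_mul_self (by linarith : -1 ≤ 1 / x) hα0 hα1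
  have hx' : x + 1 = x * (1 + 1 / x) := by field_simp
  rw [hx', Real.mul_rpow hx.le (by positivity), Real.rpow_sub_one hx.ne']
  have h2 := mul_le_mul_of_nonneg_left h (Real.rpow_nonneg hx.le α)
  calc _ ≤ x ^ α * (1 + α * (1 / x)) - x ^ α := by linarith
    _ = _ := by ring

open Filter Topology in
theorem exists_eventually_rpow_increment_le {α A B r : ℝ} (hα0 : 0 < α) (hα1 : α ≤ 1)
    (hA : 0 < A) (hr : 0 < r) (h : α = 1 → 1 < r * A) :
    ∃ q < r, ∀ᶠ k : ℕ in atTop, α * ((k : ℝ) + B) ^ (α - 1) ≤ q * A := by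
  rcases hα1.eq_or_lt with rfl | hlt
  · exact ⟨1 / A, (div_lt_iff₀ hA).2 (h rfl), .of_forall fun k => by simp [hA.ne']⟩
  · refine ⟨r / 2, by linarith, ?_⟩
    have hx : Tendsto (fun k : ℕ => (k : ℝ) + B) atTop atTop :=
      tendsto_atTop_add_const_right _ _ tendsto_natCast_atTop_atTop
    have ht := ((tendsto_rpow_neg_atTop (sub_pos.2 hlt)).comp hx).const_mul α
    rw [mul_zero] at ht
    filter_upwards [ht.eventually_lt_const (show 0 < r / 2 * A by positivity)] with k hk
    simpa using hk.le


/-- Theorem 1 of the paper (L₂ convergence rate `E‖θ^{(k)} - θ*‖² ≤ λ k^{-α}`) in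
deterministic sequence form, with the practical polynomial step size
`ω_k = A (k + B)^{-α}`. -/
theorem sgld_sa_L2_rate_polynomial_stepsize
    (α A B δ C₁ Cbar₁ C₄ : ℝ)
    (hα : α ∈ Set.Ioc (0 : ℝ) 1) (hA : 0 < A) (hB : 0 ≤ B)
    (hδ : 0 < δ) (hC₁ : 0 < C₁) (hCbar₁ : 0 < Cbar₁) (hC₄ : 0 < C₄)
    (hα1 : α = 1 → 1 < 2 * δ * A)
    (ω : ℕ → ℝ)
    (hω : ∀ k, ω k = A * ((k : ℝ) + B) ^ (-α))
    (t z : ℕ → ℝ)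
    (ht : ∀ k, 1 ≤ k → 0 ≤ t k)
    (hz : ∀ k, 1 ≤ k → |z k| ≤ C₄)
    (hrec : ∀ k, 1 ≤ k →
      t (k + 1) ≤ (1 - 2 * δ * ω (k + 1) + C₁ * (ω (k + 1)) ^ 2) * t k
        + Cbar₁ * (ω (k + 1)) ^ 2 + 2 * ω (k + 1) * (z k - z (k + 1))) :
    ∃ lam > (0 : ℝ), ∀ k, 1 ≤ k → t k ≤ lam * (k : ℝ) ^ (-α) := by
  obtain ⟨hα0, hαle⟩ := hα
  have hpos : ∀ k : ℕ, 1 ≤ k → 0 < (k : ℝ) + B := fun k hk => by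
    have : (0 : ℝ) < k := by exact_mod_cast hk
    linarith
  have hw : ∀ k, 1 ≤ k → 0 < ω k := fun k hk => by
    rw [hω]; exact mul_pos hA (Real.rpow_pos_of_pos (hpos k hk) _)
  have hx : Filter.Tendsto (fun k : ℕ => (k : ℝ) + B) Filter.atTop Filter.atTop :=
    Filter.tendsto_atTop_add_const_right _ _ tendsto_natCast_atTop_atTop
  have hw0 : Filter.Tendsto ω Filter.atTop (nhds 0) := by
    have h := ((tendsto_rpow_neg_atTop hα0).comp hx).const_mul A
    rw [mul_zero] at h
    exact h.congr fun k => (hω k).symm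
  have hanti : ∀ k, 1 ≤ k → ω (k + 1) ≤ ω k := fun k hk => by
    rw [hω, hω]
    refine mul_le_mul_of_nonneg_left ?_ hA.le
    exact Real.rpow_le_rpow_of_nonpos (hpos k hk) (by push_cast; linarith) (by linarith)
  obtain ⟨q, hq, hinc⟩ := exists_eventually_rpow_increment_le (B := B) hα0 hαle hA
    (show 0 < 2 * δ by positivity) hα1
  have hstep : ∀ᶠ k in Filter.atTop, ω k - ω (k + 1) ≤ q * (ω k * ω (k + 1)) := by
    filter_upwards [hinc, Filter.eventually_ge_atTop 1] with k hk hk1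
    have hd := (rpow_add_one_sub_rpow_le hα0.le hαle (hpos k hk1)).trans hk
    have hp := Real.rpow_pos_of_pos (hpos k hk1) α
    have hp' := Real.rpow_pos_of_pos (add_pos (hpos k hk1) one_pos) α
    rw [hω, hω, Nat.cast_succ, add_right_comm, Real.rpow_neg (hpos k hk1).le,
      Real.rpow_neg (add_pos (hpos k hk1) one_pos).le]
    generalize ((k : ℝ) + B) ^ α = a at *
    generalize ((k : ℝ) + B + 1) ^ α = b at *
    calc A * a⁻¹ - A * b⁻¹ = A * a⁻¹ * b⁻¹ * (b - a) := by field_simp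
      _ ≤ A * a⁻¹ * b⁻¹ * (q * A) := by gcongr
      _ = _ := by ring
  obtain ⟨L, hL⟩ := eventually_le_mul_stepSize_of_recursion hδ hC₁ hCbar₁ hq hw hw0 hanti
    hstep hz hrec
  obtain ⟨N, hN⟩ := Filter.eventually_atTop.1 hL
  have hs : ∀ k ∈ Finset.range N, 0 ≤ |t k| * (k : ℝ) ^ α := fun k _ => by positivity
  have hS := Finset.sum_nonneg hs
  refine ⟨|L| * A + ∑ k ∈ Finset.range N, |t k| * (k : ℝ) ^ α + 1, by positivity, ?_⟩
  intro k hk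
  have hk0 : (0 : ℝ) < k := by exact_mod_cast hk
  have hkα := Real.rpow_pos_of_pos hk0 (-α)
  rcases lt_or_ge k N with hkN | hkN
  · have h := Finset.single_le_sum hs (Finset.mem_range.2 hkN)
    calc t k ≤ |t k| := le_abs_self _
      _ = |t k| * (k : ℝ) ^ α * (k : ℝ) ^ (-α) := by
        rw [mul_assoc, ← Real.rpow_add hk0, add_neg_cancel, Real.rpow_zero, mul_one]
      _ ≤ _ := by
        gcongr
        linarith [mul_nonneg (abs_nonneg L) hA.le]
  · calc t k ≤ L * ω k := hN k hkN
      _ ≤ |L| * ω k := by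
        have := hw k hk
        gcongr
        exact le_abs_self L
      _ ≤ |L| * (A * (k : ℝ) ^ (-α)) := by
        rw [hω]
        gcongr |L| * (A * ?_)
        exact Real.rpow_le_rpow_of_nonpos hk0 (by linarith) (by linarith)
      _ = |L| * A * (k : ℝ) ^ (-α) := by ring
      _ ≤ _ := by
        gcongr
        linarith
end

section
/- Let δ, C₁, C̄₁, C₊ > 0 and let (ω_k)_{k≥1} be a positive real sequence with ω_k → 0 such that ω_{k+1} − ω_k + 2δ ω_k ω_{k+1} ≥ C₊ ω_{k+1}² for all k ≥ 1. Then there exist λ₀ > 0 and an integer k₀ such that for all λ ≥ λ₀ and all k ≥ k₀, the sequence u_k = λ ω_k satisfies u_{k+1} ≥ (1 − 2ω_{k+1}δ + ω_{k+1}² C₁) u_k + ω_{k+1}² C̄₁. -/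
/-- Lemma 4 in Appendix B of the paper: under the quantitative step-size
condition `ω_{k+1} - ω_k + 2δ ω_k ω_{k+1} ≥ C₊ ω_{k+1}²`, there exist `λ₀ > 0`
and `k₀` such that for all `λ ≥ λ₀` and `k ≥ k₀` the sequence `u_k = λ ω_k`
is a super-solution: `u_{k+1} ≥ (1 - 2ω_{k+1}δ + ω_{k+1}² C₁) u_k + ω_{k+1}² C̄₁`. -/
theorem supersolution_exists
    (δ C₁ Cbar₁ Cplus : ℝ)
    (hδ : 0 < δ) (hC₁ : 0 < C₁) (hCbar₁ : 0 < Cbar₁) (hCplus : 0 < Cplus)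
    (ω : ℕ → ℝ) (hωpos : ∀ k, 1 ≤ k → 0 < ω k)
    (hωlim : Filter.Tendsto ω Filter.atTop (nhds 0))
    (hωstep : ∀ k, 1 ≤ k →
      Cplus * (ω (k + 1)) ^ 2 ≤ ω (k + 1) - ω k + 2 * δ * ω k * ω (k + 1)) :
    ∃ lam₀ > (0 : ℝ), ∃ k₀ : ℕ, ∀ lam, lam₀ ≤ lam → ∀ k, k₀ ≤ k →
      (1 - 2 * ω (k + 1) * δ + (ω (k + 1)) ^ 2 * C₁) * (lam * ω k)
          + (ω (k + 1)) ^ 2 * Cbar₁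
        ≤ lam * ω (k + 1) := by
  have hsmall : ∀ᶠ k in Filter.atTop, ω k < Cplus / (2 * C₁) :=
    hωlim.eventually_lt_const (by positivity)
  obtain ⟨N, hN⟩ := Filter.eventually_atTop.1 hsmall
  refine ⟨2 * Cbar₁ / Cplus, by positivity, max N 1, fun lam hlam k hk => ?_⟩
  have hlam_pos : 0 < lam := lt_of_lt_of_le (by positivity) hlam
  have hω : ω k * (2 * C₁) < Cplus :=
    (lt_div_iff₀ (by positivity)).1 (hN k (le_of_max_le_left hk))
  have hCbar : 2 * Cbar₁ ≤ lam * Cplus := (div_le_iff₀ hCplus).1 hlam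
  have hstep := mul_le_mul_of_nonneg_left (hωstep k (le_of_max_le_right hk)) hlam_pos.le
  have hcoef : C₁ * (lam * ω k) + Cbar₁ ≤ lam * Cplus := by
    linarith [mul_lt_mul_of_pos_left hω hlam_pos]
  linarith [mul_le_mul_of_nonneg_left hcoef (sq_nonneg (ω (k + 1)))]
end
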